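/- Let A be a commutative ℚ-algebra, n ≥ 1, and B = A[X]/(X^n), with t the class of X. The B-linear map B → Ω¹_{B/A} sending b to b • D t is surjective, and its kernel is the ideal of B generated by t^{n-1}; hence Ω¹_{B/A} is isomorphic as a B-module to B/(t^{n-1}). -/

import Mathlib

open Polynomial

set_option maxHeartbeats 1000000
set_option synthInstance.maxHeartbeats 1000000

/-- The truncated polynomial algebra `B = A[X]/(X^n)`. -/
abbrev TruncatedPoly (A : Type*) [CommRing A] (n : ℕ) : Type _ :=
  A[X] ⧸ Ideal.span {(X : A[X]) ^ n}

/-- The class `t` of `X` in `A[X]/(X^n)`. -/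
noncomputable def truncT (A : Type*) [CommRing A] (n : ℕ) : TruncatedPoly A n :=
  Ideal.Quotient.mk _ X

/-- The target module `B/(t^{n-1})`. -/
abbrev TruncQ (A : Type*) [CommRing A] (n : ℕ) : Type _ :=
  TruncatedPoly A n ⧸ Ideal.span {truncT A n ^ (n - 1)}

theorem truncQ_smul (A : Type*) [CommRing A] (n : ℕ) (b c : TruncatedPoly A n) :
    b • (Ideal.Quotient.mk (Ideal.span {truncT A n ^ (n - 1)}) c : TruncQ A n) =
      Ideal.Quotient.mk (Ideal.span {truncT A n ^ (n - 1)}) (b * c) := rfl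

/-- The class of the derivative, as an `A`-linear map on polynomials. -/
noncomputable def truncDerPoly (A : Type*) [CommRing A] (n : ℕ) : A[X] →ₗ[A] TruncQ A n :=
  ((Ideal.Quotient.mkₐ A (Ideal.span {truncT A n ^ (n - 1)})).comp
    (Ideal.Quotient.mkₐ A (Ideal.span {(X : A[X]) ^ n}))).toLinearMap ∘ₗ derivative

theorem truncDerPoly_apply (A : Type*) [CommRing A] (n : ℕ) (p : A[X]) :
    truncDerPoly A n p = Ideal.Quotient.mk (Ideal.span {truncT A n ^ (n - 1)})
      (Ideal.Quotient.mk (Ideal.span {(X : A[X]) ^ n}) (derivative p)) := rfl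

theorem truncDerPoly_ker (A : Type*) [CommRing A] (n : ℕ) (p : A[X])
    (hp : p ∈ Ideal.span {(X : A[X]) ^ n}) : truncDerPoly A n p = 0 := by
  obtain ⟨q, rfl⟩ := Ideal.mem_span_singleton'.1 hp
  have h0 : Ideal.Quotient.mk (Ideal.span {(X : A[X]) ^ n}) (X ^ n) = 0 :=
    Ideal.Quotient.eq_zero_iff_mem.2 (Ideal.mem_span_singleton_self _)
  rw [truncDerPoly_apply, Ideal.Quotient.eq_zero_iff_mem, Ideal.mem_span_singleton']
  refine ⟨Ideal.Quotient.mk _ (q * C (n : A)), ?_⟩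
  rw [derivative_mul, derivative_X_pow, map_add, map_mul _ _ (X ^ n), h0, truncT, ← map_pow,
    ← map_mul, mul_zero, zero_add, mul_assoc]

/-- The descended `A`-linear map on `B`. -/
noncomputable def truncDerLin (A : Type*) [CommRing A] (n : ℕ) :
    TruncatedPoly A n →ₗ[A] TruncQ A n :=
  (((Ideal.span {(X : A[X]) ^ n}).restrictScalars A).liftQ (truncDerPoly A n)
    (fun p hp => truncDerPoly_ker A n p hp)) ∘ₗ
    (Submodule.Quotient.restrictScalarsEquiv A (Ideal.span {(X : A[X]) ^ n})).symm.toLinearMap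

theorem truncDerLin_mk (A : Type*) [CommRing A] (n : ℕ) (p : A[X]) :
    truncDerLin A n (Ideal.Quotient.mk _ p) = truncDerPoly A n p := rfl

/-- The derivation `B → B/(t^{n-1})`. -/
noncomputable def truncDer (A : Type*) [CommRing A] (n : ℕ) :
    Derivation A (TruncatedPoly A n) (TruncQ A n) :=
  Derivation.mk' (truncDerLin A n) (by
    intro a b
    obtain ⟨p, rfl⟩ := Ideal.Quotient.mk_surjective a
    obtain ⟨q, rfl⟩ := Ideal.Quotient.mk_surjective b
    rw [← map_mul]
    rw [truncDerLin_mk, truncDerLin_mk, truncDerLin_mk, truncDerPoly_apply, truncDerPoly_apply,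
      truncDerPoly_apply, truncQ_smul, truncQ_smul, derivative_mul, ← map_mul, ← map_mul,
      ← map_add, ← map_add]
    congr 2
    ring)

theorem truncDer_t (A : Type*) [CommRing A] (n : ℕ) : truncDer A n (truncT A n) = 1 := by
  change truncDerPoly A n X = 1
  rw [truncDerPoly_apply, derivative_X, map_one, map_one]

theorem trunc_surj (A : Type*) [CommRing A] (n : ℕ) :
    Function.Surjective
      (LinearMap.toSpanSingleton (TruncatedPoly A n)
        (KaehlerDifferential A (TruncatedPoly A n))
        (KaehlerDifferential.D A (TruncatedPoly A n) (truncT A n))) := by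
  rw [← LinearMap.range_eq_top, ← top_le_iff,
    ← KaehlerDifferential.span_range_derivation, Submodule.span_le]
  rintro _ ⟨b, rfl⟩
  obtain ⟨p, rfl⟩ := Ideal.Quotient.mk_surjective b
  have : Ideal.Quotient.mk (Ideal.span {(X : A[X]) ^ n}) p = aeval (truncT A n) p := by
    have h := aeval_algHom_apply (Ideal.Quotient.mkₐ A (Ideal.span {(X : A[X]) ^ n})) X p
    rw [aeval_X_left_apply] at h
    exact h.symm
  rw [this, Derivation.map_aeval]
  exact ⟨_, rfl⟩

theorem trunc_ker (A : Type*) [CommRing A] [Algebra ℚ A] (n : ℕ) (hn : 1 ≤ n) :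
    LinearMap.ker
      (LinearMap.toSpanSingleton (TruncatedPoly A n)
        (KaehlerDifferential A (TruncatedPoly A n))
        (KaehlerDifferential.D A (TruncatedPoly A n) (truncT A n))) =
      Ideal.span {truncT A n ^ (n - 1)} := by
  apply le_antisymm
  · intro b hb
    rw [LinearMap.mem_ker, LinearMap.toSpanSingleton_apply] at hb
    have h := congrArg (truncDer A n).liftKaehlerDifferential hb
    rw [map_smul, Derivation.liftKaehlerDifferential_comp_D, truncDer_t, map_zero,
      ← map_one (Ideal.Quotient.mk _), truncQ_smul, mul_one] at h
    exact Ideal.Quotient.eq_zero_iff_mem.1 h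
  · rw [Ideal.span_le, Set.singleton_subset_iff, SetLike.mem_coe, LinearMap.mem_ker,
      LinearMap.toSpanSingleton_apply]
    have h0 : truncT A n ^ n = 0 := by
      rw [truncT, ← map_pow]
      exact Ideal.Quotient.eq_zero_iff_mem.2 (Ideal.mem_span_singleton_self _)
    have h := Derivation.leibniz_pow (KaehlerDifferential.D A (TruncatedPoly A n)) (truncT A n) n
    rw [h0, map_zero, ← Nat.cast_smul_eq_nsmul A] at h
    have hu : IsUnit ((n : ℕ) : A) := by
      have : IsUnit ((n : ℕ) : ℚ) := isUnit_iff_ne_zero.2 (by positivity)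
      simpa using this.map (algebraMap ℚ A)
    exact (hu.smul_eq_zero).1 h.symm

/-- For a commutative `ℚ`-algebra `A`, `n ≥ 1` and `B = A[X]/(X^n)` with `t` the class of
`X`, the `B`-linear map `B → Ω¹_{B/A}`, `b ↦ b • D t`, is surjective with kernel the ideal
generated by `t^{n-1}`; hence `Ω¹_{B/A} ≅ B/(t^{n-1})` as `B`-modules. -/
theorem truncatedPoly_kaehler_structure (A : Type*) [CommRing A] [Algebra ℚ A]
    (n : ℕ) (hn : 1 ≤ n) :
    Function.Surjective
      (LinearMap.toSpanSingleton (TruncatedPoly A n)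
        (KaehlerDifferential A (TruncatedPoly A n))
        (KaehlerDifferential.D A (TruncatedPoly A n) (truncT A n))) ∧
    LinearMap.ker
      (LinearMap.toSpanSingleton (TruncatedPoly A n)
        (KaehlerDifferential A (TruncatedPoly A n))
        (KaehlerDifferential.D A (TruncatedPoly A n) (truncT A n))) =
      Ideal.span {truncT A n ^ (n - 1)} ∧
    Nonempty
      (KaehlerDifferential A (TruncatedPoly A n) ≃ₗ[TruncatedPoly A n]
        TruncatedPoly A n ⧸ Ideal.span {truncT A n ^ (n - 1)}) := by
  refine ⟨trunc_surj A n, trunc_ker A n hn, ⟨?_⟩⟩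
  exact (LinearMap.quotKerEquivOfSurjective _ (trunc_surj A n)).symm.trans
    (Submodule.quotEquivOfEq _ _ (trunc_ker A n hn))
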